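/- For every integer n ≥ 1 and every real p > 0, ∫₀¹ P_{4n,-}(x)^p dx ≤ (3π²/(4n + 1/2)²) · Σ_{i=1}^{n} i · y_{2i−1,4n}^p. -/

import Mathlib

open MeasureTheory Filter

/-- The `n`-th Legendre polynomial, via Rodrigues formula:
`P_n(x) = (1/(2^n n!)) (d/dx)^n (x^2 - 1)^n`. -/
noncomputable def legP (n : ℕ) : ℝ → ℝ := fun x =>
  (1 / ((2 : ℝ) ^ n * (n.factorial : ℝ))) *
    iteratedDeriv n (fun y : ℝ => (y ^ 2 - 1) ^ n) x

/-- Positive part of the `n`-th Legendre polynomial. -/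
noncomputable def legPpos (n : ℕ) (x : ℝ) : ℝ := max (legP n x) 0

/-- Negative part of the `n`-th Legendre polynomial. -/
noncomputable def legPneg (n : ℕ) (x : ℝ) : ℝ := max (-legP n x) 0

section Aux
open Polynomial

theorem sturm_pos (P : ℝ[X]) (ω a : ℝ) (M : ℝ) (hω : 0 < ω) (hM : ω ^ 2 = M + 1 / 4)
    (hode : ∀ x : ℝ, (x ^ 2 - 1) * (derivative (derivative P)).eval x
      + 2 * x * (derivative P).eval x - M * P.eval x = 0)
    (ha : 0 < a) (hb : a + Real.pi / ω < Real.pi)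
    (hpos : ∀ t ∈ Set.Ioo a (a + Real.pi / ω), 0 < P.eval (Real.cos t)) : False := by
  have hh : 0 < Real.pi / ω := by positivity
  set b := a + Real.pi / ω with hbdef
  have hab : a < b := by linarith
  have hsin : ∀ t ∈ Set.Icc a b, 0 < Real.sin t := fun t ht =>
    Real.sin_pos_of_pos_of_lt_pi (by linarith [ht.1]) (by linarith [ht.2])
  let W : ℝ → ℝ := fun t =>
    (Real.sin t * (-Real.sin t * (derivative P).eval (Real.cos t) * Real.sin (ω * (t - a))
      - P.eval (Real.cos t) * (ω * Real.cos (ω * (t - a))))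
      + Real.cos t * P.eval (Real.cos t) * Real.sin (ω * (t - a)) / 2) / √(Real.sin t)
  have hder : ∀ t ∈ Set.Icc a b, HasDerivAt W
      (-(P.eval (Real.cos t) * Real.sin (ω * (t - a))) / (4 * Real.sin t * √(Real.sin t))) t := by
    intro t ht
    have hs := hsin t ht
    have h1 : HasDerivAt (fun t => P.eval (Real.cos t))
        ((derivative P).eval (Real.cos t) * (-Real.sin t)) t :=
      (P.hasDerivAt (Real.cos t)).comp t (Real.hasDerivAt_cos t)
    have h2 : HasDerivAt (fun t => (derivative P).eval (Real.cos t))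
        ((derivative (derivative P)).eval (Real.cos t) * (-Real.sin t)) t :=
      ((derivative P).hasDerivAt (Real.cos t)).comp t (Real.hasDerivAt_cos t)
    have h0 : HasDerivAt (fun t => ω * (t - a)) (ω * 1) t :=
      ((hasDerivAt_id t).sub_const a).const_mul ω
    have hS := h0.sin
    have hC := h0.cos
    have hsn := Real.hasDerivAt_sin t
    have hcs := Real.hasDerivAt_cos t
    have hq := hsn.sqrt hs.ne'
    have hsq : √(Real.sin t) ≠ 0 := (Real.sqrt_pos.2 hs).ne'
    have key := ((hsn.mul ((((hsn.neg).mul h2).mul hS).sub (h1.mul (hC.const_mul ω)))).add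
      (((hcs.mul h1).mul hS).div_const 2)).div hq hsq
    refine HasDerivAt.congr_deriv (f := W) key ?_
    simp only [Pi.mul_apply, Pi.neg_apply, Pi.sub_apply, Pi.add_apply]
    clear key
    have e := hode (Real.cos t)
    have hr : √(Real.sin t) ^ 2 = Real.sin t := Real.sq_sqrt hs.le
    have hcc := Real.sin_sq_add_cos_sq t
    generalize √(Real.sin t) = r at *
    generalize Real.sin t = s at *
    generalize Real.cos t = c at *
    generalize Real.sin (ω * (t - a)) = S at *
    generalize Real.cos (ω * (t - a)) = C at *
    generalize eval c P = p0 at *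
    generalize eval c (derivative P) = p1 at *
    generalize eval c (derivative (derivative P)) = p2 at *
    have hMe : M = ω ^ 2 - 1 / 4 := by linarith
    subst hMe
    subst hr
    have hc2 : c ^ 2 = 1 - (r ^ 2) ^ 2 := by linarith
    rw [hc2] at e
    field_simp
    have e2 : (r ^ 2) ^ 2 * p2 = 2 * c * p1 - (ω ^ 2 - 1 / 4) * p0 := by linarith
    linear_combination (16 * S * r ^ 4) * e2 + (-4 * p0 * S) * hc2
  have hanti : StrictAntiOn W (Set.Icc a b) := by
    apply strictAntiOn_of_deriv_neg (convex_Icc a b)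
    · exact fun t ht => (hder t ht).continuousAt.continuousWithinAt
    · intro t ht
      rw [interior_Icc] at ht
      have ht' := Set.Ioo_subset_Icc_self ht
      rw [(hder t ht').deriv]
      have h1 := hpos t ht
      have h2 := hsin t ht'
      have h3 : 0 < Real.sin (ω * (t - a)) := by
        apply Real.sin_pos_of_pos_of_lt_pi
        · exact mul_pos hω (by linarith [ht.1])
        · have : t - a < Real.pi / ω := by linarith [ht.2]
          rw [lt_div_iff₀ hω] at this
          linarith
      rw [neg_div]
      have := Real.sqrt_pos.2 h2
      have : 0 < eval (Real.cos t) P * Real.sin (ω * (t - a)) /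
        (4 * Real.sin t * √(Real.sin t)) := by positivity
      linarith
  have hcl : ∀ t ∈ Set.Icc a b, 0 ≤ P.eval (Real.cos t) := by
    have hcont : Continuous fun t => P.eval (Real.cos t) := P.continuous.comp Real.continuous_cos
    intro t ht
    rw [← closure_Ioo hab.ne] at ht
    exact closure_minimal (fun t ht => (hpos t ht).le) (isClosed_le continuous_const hcont) ht
  have hWa : W a ≤ 0 := by
    have h1 := hcl a ⟨le_rfl, hab.le⟩
    have h2 := hsin a ⟨le_rfl, hab.le⟩
    simp only [W, sub_self, mul_zero, Real.sin_zero, Real.cos_zero]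
    apply div_nonpos_of_nonpos_of_nonneg _ (Real.sqrt_nonneg _)
    have : 0 ≤ Real.sin a * (P.eval (Real.cos a) * ω) := by positivity
    linarith
  have hWb : 0 ≤ W b := by
    have h1 := hcl b ⟨hab.le, le_rfl⟩
    have h2 := hsin b ⟨hab.le, le_rfl⟩
    have h3 : ω * (b - a) = Real.pi := by rw [hbdef]; field_simp; ring
    simp only [W, h3, Real.sin_pi, Real.cos_pi]
    apply div_nonneg _ (Real.sqrt_nonneg _)
    have : 0 ≤ Real.sin b * (P.eval (Real.cos b) * ω) := by positivity
    linarith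
  have := hanti ⟨le_rfl, hab.le⟩ ⟨hab.le, le_rfl⟩ hab
  linarith

theorem sturm_zero (P : ℝ[X]) (ω a : ℝ) (M : ℝ) (hω : 0 < ω) (hM : ω ^ 2 = M + 1 / 4)
    (hode : ∀ x : ℝ, (x ^ 2 - 1) * (derivative (derivative P)).eval x
      + 2 * x * (derivative P).eval x - M * P.eval x = 0)
    (ha : 0 < a) (hb : a + Real.pi / ω < Real.pi) :
    ∃ t ∈ Set.Ioo a (a + Real.pi / ω), P.eval (Real.cos t) = 0 := by
  by_contra hcon
  push Not at hcon
  have hcont : Continuous fun t => P.eval (Real.cos t) := P.continuous.comp Real.continuous_cos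
  have hpre : IsPreconnected (Set.Ioo a (a + Real.pi / ω)) := isPreconnected_Ioo
  by_cases h : ∀ t ∈ Set.Ioo a (a + Real.pi / ω), 0 < P.eval (Real.cos t)
  · exact sturm_pos P ω a M hω hM hode ha hb h
  · push Not at h
    obtain ⟨t0, ht0, hle⟩ := h
    refine sturm_pos (-P) ω a M hω hM ?_ ha hb ?_
    · intro x
      have := hode x
      simp only [derivative_neg, eval_neg]
      linarith
    · intro t ht
      by_contra hlt
      simp only [eval_neg] at hlt
      obtain ⟨s, hs, h0⟩ := hpre.intermediate_value ht0 ht hcont.continuousOn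
        (show (0:ℝ) ∈ Set.Icc _ _ from ⟨hle, by linarith⟩)
      exact hcon s hs h0

theorem rod_ode (N : ℕ) (d : ℕ → ℝ[X]) (h0 : d 0 = (X ^ 2 - 1) ^ N)
    (hd : ∀ k, derivative (d k) = d (k + 1)) (k : ℕ) :
    (X ^ 2 - 1) * d (k + 2) + 2 * ((k : ℝ[X]) + 1) * X * d (k + 1)
      + ((k : ℝ[X]) + 1) * (k : ℝ[X]) * d k
      = 2 * (N : ℝ[X]) * X * d (k + 1) + 2 * (N : ℝ[X]) * ((k : ℝ[X]) + 1) * d k := by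
  have hC2 : (C 2 : ℝ[X]) = 2 := rfl
  induction k with
  | zero =>
    have h1 : (X ^ 2 - 1) * d 1 = 2 * (N : ℝ[X]) * X * d 0 := by
      rw [← hd 0, h0]
      rcases N with _ | m
      · simp
      · simp [derivative_pow, hC2]
        ring
    have h2 := congrArg derivative h1
    simp [hd, hC2] at h2 ⊢
    linear_combination h2
  | succ k ih =>
    have h2 := congrArg derivative ih
    simp [hd, hC2] at h2
    push_cast
    linear_combination h2

noncomputable def legPoly (N : ℕ) : ℝ[X] :=
  C (1 / ((2 : ℝ) ^ N * (N.factorial : ℝ))) * derivative^[N] ((X ^ 2 - 1) ^ N)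

theorem iteratedDeriv_poly (q : ℝ[X]) (k : ℕ) :
    iteratedDeriv k (fun x => q.eval x) = fun x => (derivative^[k] q).eval x := by
  induction k generalizing q with
  | zero => simp
  | succ k ih =>
    rw [iteratedDeriv_succ']
    have : deriv (fun x => q.eval x) = fun x => (derivative q).eval x := by
      ext x; simp
    rw [this, ih]
    rfl

theorem legP_eq (N : ℕ) (x : ℝ) : legP N x = (legPoly N).eval x := by
  have := iteratedDeriv_poly ((X ^ 2 - 1) ^ N) N
  simp only [eval_pow, eval_sub, eval_X, eval_one] at this
  simp only [legP, legPoly, this, eval_mul, eval_C]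

theorem legP_even (N : ℕ) (hN : Even N) (x : ℝ) : legP N (-x) = legP N x := by
  have := iteratedDeriv_comp_neg N (fun y : ℝ => (y ^ 2 - 1) ^ N) x
  simp only [neg_sq, hN.neg_one_pow, one_smul] at this
  simp only [legP, this]

theorem leg_ode (N : ℕ) (x : ℝ) : (x ^ 2 - 1) * (derivative (derivative (legPoly N))).eval x
      + 2 * x * (derivative (legPoly N)).eval x - ((N : ℝ) * (N + 1)) * (legPoly N).eval x = 0 := by
  have h := rod_ode N (fun k => derivative^[k] ((X ^ 2 - 1) ^ N)) rfl
    (fun k => (Function.iterate_succ_apply' derivative k _).symm) N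
  have h' := congrArg (eval x) h
  simp only [Function.iterate_succ_apply', eval_add, eval_mul, eval_sub, eval_pow, eval_X, eval_one,
    eval_natCast, eval_ofNat] at h'
  simp only [legPoly, derivative_C_mul, eval_mul, eval_C]
  linear_combination (1 / ((2 : ℝ) ^ N * (N.factorial : ℝ))) * h'

theorem monic_base : (X ^ 2 - 1 : ℝ[X]).Monic := by
  have := monic_X_pow_sub_C (1:ℝ) (n := 2) (by norm_num)
  simpa using this

theorem natDegree_base : (X ^ 2 - 1 : ℝ[X]).natDegree = 2 := by
  have := natDegree_X_pow_sub_C (n := 2) (r := (1:ℝ))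
  simpa using this

theorem leg_coeff_pos (N : ℕ) : 0 < (legPoly N).coeff N := by
  rw [legPoly, coeff_C_mul, coeff_iterate_derivative]
  have hm := monic_base.pow N
  have hd : ((X ^ 2 - 1 : ℝ[X]) ^ N).natDegree = N + N := by
    rw [monic_base.natDegree_pow, natDegree_base]; ring
  have : ((X ^ 2 - 1 : ℝ[X]) ^ N).coeff (N + N) = 1 := by
    rw [← hd]; exact hm
  rw [this]
  have : 0 < (N + N).descFactorial N := Nat.descFactorial_pos.2 (by omega)
  simp only [nsmul_eq_mul, mul_one]
  positivity

theorem leg_degree_le (N : ℕ) : (legPoly N).natDegree ≤ N := by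
  rw [legPoly]
  refine (natDegree_C_mul_le _ _).trans ?_
  refine (natDegree_iterate_derivative _ _).trans ?_
  rw [monic_base.natDegree_pow, natDegree_base]
  omega

/-- Factorization from the full list of zeros. -/
theorem leg_factor (n : ℕ) (z : ℕ → ℝ)
    (hzmem : ∀ k, 1 ≤ k → k ≤ 2 * n →
      z k ∈ Set.Ioo (0:ℝ) 1 ∧ legP (4 * n) (z k) = 0)
    (hzanti : ∀ k l, 1 ≤ k → k < l → l ≤ 2 * n → z l < z k) (x : ℝ) :
    legP (4 * n) x = (legPoly (4 * n)).coeff (4 * n) *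
      ∏ i ∈ Finset.Icc 1 n, ((x ^ 2 - z (2 * i) ^ 2) * (x ^ 2 - z (2 * i - 1) ^ 2)) := by
  set c := (legPoly (4 * n)).coeff (4 * n) with hc
  have hcpos : 0 < c := leg_coeff_pos _
  let F : ℕ → ℝ[X] := fun i => (X ^ 2 - C (z (2 * i) ^ 2)) * (X ^ 2 - C (z (2 * i - 1) ^ 2))
  let Q : ℝ[X] := ∏ i ∈ Finset.Icc 1 n, F i
  have hFm : ∀ i, (F i).Monic := fun i =>
    (monic_X_pow_sub_C _ (by norm_num)).mul (monic_X_pow_sub_C _ (by norm_num))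
  have hFd : ∀ i, (F i).natDegree = 4 := fun i => by
    rw [Monic.natDegree_mul (monic_X_pow_sub_C _ (by norm_num)) (monic_X_pow_sub_C _ (by norm_num)),
      natDegree_X_pow_sub_C, natDegree_X_pow_sub_C]
  have hQm : Q.Monic := monic_prod_of_monic _ _ fun i _ => hFm i
  have hQd : Q.natDegree = 4 * n := by
    rw [natDegree_prod_of_monic _ _ fun i _ => hFm i]
    simp [hFd, mul_comm]
  have hQe : ∀ x, Q.eval x =
      ∏ i ∈ Finset.Icc 1 n, ((x ^ 2 - z (2 * i) ^ 2) * (x ^ 2 - z (2 * i - 1) ^ 2)) := by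
    intro x
    simp [Q, F, eval_prod]
  have hinj : Set.InjOn z (Finset.Icc 1 (2 * n) : Finset ℕ) := by
    intro k hk l hl h
    simp only [Finset.coe_Icc, Set.mem_Icc] at hk hl
    rcases lt_trichotomy k l with h' | h' | h'
    · exact absurd h (hzanti k l hk.1 h' hl.2).ne'
    · exact h'
    · exact absurd h (hzanti l k hl.1 h' hk.2).ne
  let A : Finset ℝ := (Finset.Icc 1 (2 * n)).image z
  let B : Finset ℝ := A.image (fun x => -x)
  have hA : A.card = 2 * n := by rw [Finset.card_image_of_injOn hinj]; simp
  have hB : B.card = 2 * n := by rw [Finset.card_image_of_injective _ neg_injective, hA]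
  have hApos : ∀ x ∈ A, 0 < x := by
    intro x hx
    obtain ⟨k, hk, rfl⟩ := Finset.mem_image.1 hx
    rw [Finset.mem_Icc] at hk
    exact (hzmem k hk.1 hk.2).1.1
  have hdisj : Disjoint A B := by
    rw [Finset.disjoint_left]
    intro x hx hx'
    obtain ⟨w, hw, rfl⟩ := Finset.mem_image.1 hx'
    linarith [hApos _ hx, hApos _ hw]
  have hcard : (A ∪ B).card = 4 * n := by
    rw [Finset.card_union_of_disjoint hdisj, hA, hB]; ring
  have hEA : ∀ x ∈ A, (legPoly (4 * n)).eval x = 0 ∧ Q.eval x = 0 := by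
    intro x hx
    obtain ⟨k, hk, rfl⟩ := Finset.mem_image.1 hx
    rw [Finset.mem_Icc] at hk
    refine ⟨by rw [← legP_eq]; exact (hzmem k hk.1 hk.2).2, ?_⟩
    rw [hQe]
    rcases Nat.even_or_odd' k with ⟨i, rfl | rfl⟩
    · exact Finset.prod_eq_zero (i := i) (Finset.mem_Icc.2 ⟨by omega, by omega⟩) (by simp)
    · exact Finset.prod_eq_zero (i := i + 1) (Finset.mem_Icc.2 ⟨by omega, by omega⟩) (by
        rw [show 2 * (i + 1) - 1 = 2 * i + 1 by omega]; simp)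
  have heq : legPoly (4 * n) = C c * Q := by
    apply eq_of_degree_sub_lt_of_eval_finset_eq (A ∪ B)
    · rw [hcard]
      have hle : (legPoly (4 * n) - C c * Q).natDegree ≤ 4 * n := by
        refine (natDegree_sub_le _ _).trans (max_le (leg_degree_le _) ?_)
        exact (natDegree_C_mul_le _ _).trans hQd.le
      have h0 : (legPoly (4 * n) - C c * Q).coeff (4 * n) = 0 := by
        have : Q.coeff (4 * n) = 1 := by rw [← hQd]; exact hQm
        rw [coeff_sub, coeff_C_mul, this, hc]; ring
      rw [degree_lt_iff_coeff_zero]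
      intro m hm
      rcases hm.eq_or_lt with rfl | hm
      · exact h0
      · exact coeff_eq_zero_of_natDegree_lt (hle.trans_lt hm)
    · intro x hx
      rcases Finset.mem_union.1 hx with hx | hx
      · simp [hEA x hx]
      · obtain ⟨w, hw, rfl⟩ := Finset.mem_image.1 hx
        have h1 : (legPoly (4 * n)).eval (-w) = 0 := by
          rw [← legP_eq, legP_even _ ⟨2 * n, by ring⟩, legP_eq]; exact (hEA w hw).1
        have h2 : Q.eval (-w) = 0 := by
          rw [← (hEA w hw).2, hQe, hQe]; simp
        simp [h1, h2]
  rw [legP_eq, ← hQe]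
  nth_rewrite 1 [heq]
  simp

theorem cos_sub_le (a b : ℝ) (ha : 0 ≤ a) (hab : a ≤ b) (hb : b ≤ Real.pi) :
    Real.cos a - Real.cos b ≤ b * (b - a) := by
  have h : Real.cos a - Real.cos b = 2 * Real.sin ((a + b) / 2) * Real.sin ((b - a) / 2) := by
    rw [Real.cos_sub_cos, show (a - b) / 2 = -((b - a) / 2) by ring, Real.sin_neg]; ring
  have h1 : Real.sin ((a + b) / 2) ≤ (a + b) / 2 := Real.sin_le (by linarith)
  have h2 : Real.sin ((b - a) / 2) ≤ (b - a) / 2 := Real.sin_le (by linarith)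
  have h3 : 0 ≤ Real.sin ((b - a) / 2) :=
    Real.sin_nonneg_of_nonneg_of_le_pi (by linarith) (by linarith)
  have h4 := mul_le_mul h1 h2 h3 (by linarith : 0 ≤ (a + b) / 2)
  rw [h]
  nlinarith

theorem zero_gap (n : ℕ) (z : ℕ → ℝ)
    (hzmem : ∀ k, 1 ≤ k → k ≤ 2 * n →
      z k ∈ Set.Ioo (0:ℝ) 1 ∧ legP (4 * n) (z k) = 0)
    (hzanti : ∀ k l, 1 ≤ k → k < l → l ≤ 2 * n → z l < z k)
    (hzall : ∀ x ∈ Set.Ioo (0:ℝ) 1, legP (4 * n) x = 0 →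
      ∃ k, 1 ≤ k ∧ k ≤ 2 * n ∧ x = z k) (i : ℕ) (hi : 1 ≤ i) (hin : i ≤ n) :
    z (2 * i - 1) - z (2 * i) ≤ 3 * Real.pi ^ 2 / (4 * (n : ℝ) + 1 / 2) ^ 2 * i := by
  set ω : ℝ := 4 * (n : ℝ) + 1 / 2 with hω
  have hωpos : 0 < ω := by positivity
  set h := Real.pi / ω with hh
  have hpos : 0 < h := by positivity
  let θ : ℕ → ℝ := fun k => Real.arccos (z k)
  have hcos : ∀ k, 1 ≤ k → k ≤ 2 * n → Real.cos (θ k) = z k := fun k h1 h2 =>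
    Real.cos_arccos (by linarith [(hzmem k h1 h2).1.1]) (hzmem k h1 h2).1.2.le
  have hθpos : ∀ k, 1 ≤ k → k ≤ 2 * n → 0 < θ k := fun k h1 h2 =>
    Real.arccos_pos.2 (hzmem k h1 h2).1.2
  have hθlt : ∀ k, 1 ≤ k → k ≤ 2 * n → θ k < Real.pi / 2 := fun k h1 h2 =>
    Real.arccos_lt_pi_div_two.2 (hzmem k h1 h2).1.1
  have hex : ∀ a, 0 < a → a + h < Real.pi / 2 →
      ∃ k, 1 ≤ k ∧ k ≤ 2 * n ∧ a < θ k ∧ θ k < a + h := by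
    intro a ha hb
    obtain ⟨t, ht, h0⟩ := sturm_zero (legPoly (4 * n)) ω a (((4 * n : ℕ) : ℝ) * ((4 * n : ℕ) + 1))
      hωpos (by rw [hω]; push_cast; ring) (leg_ode (4 * n)) ha (by linarith [Real.pi_pos])
    have ht1 : a < t := ht.1
    have ht2 : t < a + h := ht.2
    obtain ⟨k, hk1, hk2, hk⟩ := hzall (Real.cos t)
      ⟨Real.cos_pos_of_mem_Ioo ⟨by linarith, by linarith⟩, by
        rw [← Real.cos_zero]
        exact Real.cos_lt_cos_of_nonneg_of_le_pi le_rfl (by linarith) (by linarith)⟩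
      (by rw [legP_eq]; exact h0)
    have : θ k = t := by
      simp only [θ]
      rw [← hk, Real.arccos_cos (by linarith) (by linarith)]
    exact ⟨k, hk1, hk2, by rw [this]; exact ⟨ht1, ht2⟩⟩
  have hθmono : ∀ k l, 1 ≤ k → k < l → l ≤ 2 * n → θ k < θ l := fun k l h1 h2 h3 =>
    Real.arccos_lt_arccos (by linarith [(hzmem l (by omega) h3).1.1]) (hzanti k l h1 h2 h3)
      (hzmem k h1 (by omega)).1.2.le
  have hstep : ∀ k, 1 ≤ k → k + 1 ≤ 2 * n → θ (k + 1) ≤ θ k + h := by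
    intro k h1 h2
    by_contra hcon
    push Not at hcon
    obtain ⟨j, hj1, hj2, hj3, hj4⟩ := hex (θ k) (hθpos k h1 (by omega))
      (by linarith [hθlt (k + 1) (by omega) h2])
    rcases Nat.lt_or_ge k j with hkj | hkj
    · rcases Nat.lt_or_ge (k + 1) j with hkj' | hkj'
      · linarith [hθmono (k + 1) j (by omega) hkj' hj2]
      · have : j = k + 1 := by omega
        subst this
        linarith
    · rcases hkj.eq_or_lt with rfl | hkj
      · linarith
      · linarith [hθmono j k hj1 hkj (by omega)]
  have hfirst : θ 1 ≤ h / 2 + h := by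
    by_contra hcon
    push Not at hcon
    obtain ⟨j, hj1, hj2, hj3, hj4⟩ := hex (h / 2) (by linarith)
      (by linarith [hθlt 1 le_rfl (by omega)])
    rcases hj1.eq_or_lt with rfl | hj
    · linarith
    · linarith [hθmono 1 j le_rfl hj hj2]
  have hall : ∀ k, k + 1 ≤ 2 * n → θ (k + 1) ≤ (k + 3 / 2) * h := by
    intro k
    induction k with
    | zero => intro _; simp only [zero_add, Nat.cast_zero]; linarith
    | succ k ih =>
      intro hk
      have := hstep (k + 1) (by omega) hk
      have := ih (by omega)
      push_cast
      linarith
  obtain ⟨m, rfl⟩ : ∃ m, i = m + 1 := ⟨i - 1, by omega⟩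
  have e1 : 2 * (m + 1) - 1 = 2 * m + 1 := by omega
  have e2 : 2 * (m + 1) = 2 * m + 1 + 1 := by omega
  rw [e1, e2]
  have g1 := hall (2 * m + 1) (by omega)
  have g2 := hstep (2 * m + 1) (by omega) (by omega)
  have g3 := hθmono (2 * m + 1) (2 * m + 1 + 1) (by omega) (by omega) (by omega)
  have g4 := hθpos (2 * m + 1) (by omega) (by omega)
  have g5 := hθlt (2 * m + 1 + 1) (by omega) (by omega)
  have g6 := cos_sub_le _ _ g4.le g3.le (by linarith [Real.pi_pos])
  rw [hcos _ (by omega) (by omega), hcos _ (by omega) (by omega)] at g6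
  have e3 : 3 * Real.pi ^ 2 / ω ^ 2 * ((m + 1 : ℕ) : ℝ) = (3 * (m + 1) * h) * h := by
    rw [hh]; push_cast; field_simp
  rw [e3]
  refine g6.trans (mul_le_mul ?_ (by linarith) (by linarith) (by positivity))
  refine g1.trans ?_
  apply mul_le_mul_of_nonneg_right _ hpos.le
  push_cast
  have : (0:ℝ) ≤ m := Nat.cast_nonneg m
  linarith

end Aux

/-- $∫_0^1 P_{4n,-}^p ≤ (3π²/(4n+1/2)²) Σ_{i=1}^n i\, y_{2i-1,4n}^p$, where
$z_{k,4n}$ enumerates the zeros of $P_{4n}$ in $(0,1)$ in decreasing order and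
$y_{2i-1,4n}$ is the sup of $|P_{4n}|$ on $[z_{2i,4n}, z_{2i-1,4n}]$. -/
theorem integral_legPneg_le (n : ℕ) (hn : 1 ≤ n) (p : ℝ) (hp : 0 < p)
    (z : ℕ → ℝ)
    (hzmem : ∀ k, 1 ≤ k → k ≤ 2 * n →
      z k ∈ Set.Ioo (0:ℝ) 1 ∧ legP (4 * n) (z k) = 0)
    (hzanti : ∀ k l, 1 ≤ k → k < l → l ≤ 2 * n → z l < z k)
    (hzall : ∀ x ∈ Set.Ioo (0:ℝ) 1, legP (4 * n) x = 0 →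
      ∃ k, 1 ≤ k ∧ k ≤ 2 * n ∧ x = z k)
    (y : ℕ → ℝ)
    (hy : ∀ i, 1 ≤ i → i ≤ n →
      IsLUB ((fun x => |legP (4 * n) x|) '' Set.Icc (z (2 * i)) (z (2 * i - 1))) (y i)) :
    (∫ x in (0:ℝ)..1, (legPneg (4 * n) x) ^ p) ≤
      (3 * Real.pi ^ 2 / (4 * (n : ℝ) + 1 / 2) ^ 2) *
        ∑ i ∈ Finset.Icc 1 n, (i : ℝ) * (y i) ^ p := by
  have hcont : Continuous (legP (4 * n)) := by
    have : legP (4 * n) = fun x => (legPoly (4 * n)).eval x := funext (legP_eq _)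
    rw [this]; exact (legPoly (4 * n)).continuous
  have hord : ∀ i, 1 ≤ i → i ≤ n → z (2 * i) < z (2 * i - 1) := fun i h1 h2 =>
    hzanti _ _ (by omega) (by omega) (by omega)
  have hy0 : ∀ i, 1 ≤ i → i ≤ n → 0 ≤ y i := fun i h1 h2 =>
    (abs_nonneg _).trans ((hy i h1 h2).1 ⟨z (2 * i), ⟨le_rfl, (hord i h1 h2).le⟩, rfl⟩)
  have hcontF : Continuous fun x => (legPneg (4 * n) x) ^ p := by
    have : Continuous (legPneg (4 * n)) := (hcont.neg).max continuous_const
    exact this.rpow_const fun x => Or.inr hp.le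
  let G : ℕ → ℝ → ℝ := fun i =>
    (Set.Icc (z (2 * i)) (z (2 * i - 1))).indicator (fun _ => (y i) ^ p)
  have hGnn : ∀ i ∈ Finset.Icc 1 n, ∀ x, 0 ≤ G i x := by
    intro i hi x
    rw [Finset.mem_Icc] at hi
    exact Set.indicator_nonneg (fun _ _ => Real.rpow_nonneg (hy0 i hi.1 hi.2) p) x
  have hGint : ∀ i ∈ Finset.Icc 1 n, Integrable (G i) volume := by
    intro i _
    exact (integrable_indicator_iff measurableSet_Icc).2 (by simp)
  have hpt : ∀ x, 0 ≤ x → (legPneg (4 * n) x) ^ p ≤ ∑ i ∈ Finset.Icc 1 n, G i x := by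
    intro x hx
    by_cases hex : ∃ i, 1 ≤ i ∧ i ≤ n ∧ x ∈ Set.Icc (z (2 * i)) (z (2 * i - 1))
    · obtain ⟨i, h1, h2, hxi⟩ := hex
      have hmem : i ∈ Finset.Icc 1 n := Finset.mem_Icc.2 ⟨h1, h2⟩
      refine le_trans ?_ (Finset.single_le_sum (fun j hj => hGnn j hj x) hmem)
      simp only [G, Set.indicator_of_mem hxi]
      apply Real.rpow_le_rpow (le_max_right _ _) _ hp.le
      exact max_le ((neg_le_abs _).trans ((hy i h1 h2).1 ⟨x, hxi, rfl⟩)) (hy0 i h1 h2)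
    · push Not at hex
      have hnn : 0 ≤ legP (4 * n) x := by
        rw [leg_factor n z hzmem hzanti x]
        apply mul_nonneg (leg_coeff_pos _).le
        apply Finset.prod_nonneg
        intro i hi
        rw [Finset.mem_Icc] at hi
        have hno := hex i hi.1 hi.2
        have ho := hord i hi.1 hi.2
        have hp1 := (hzmem (2 * i) (by omega) (by omega)).1.1
        rw [Set.mem_Icc, not_and_or, not_le, not_le] at hno
        rcases hno with hno | hno
        · apply mul_nonneg_of_nonpos_of_nonpos <;> nlinarith
        · apply mul_nonneg <;> nlinarith
      have : legPneg (4 * n) x = 0 := max_eq_right (by linarith)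
      rw [this, Real.zero_rpow hp.ne']
      exact Finset.sum_nonneg fun j hj => hGnn j hj x
  have hsumint : Integrable (fun x => ∑ i ∈ Finset.Icc 1 n, G i x) volume :=
    integrable_finsetSum _ hGint
  calc (∫ x in (0:ℝ)..1, (legPneg (4 * n) x) ^ p)
      ≤ ∫ x in (0:ℝ)..1, ∑ i ∈ Finset.Icc 1 n, G i x := by
        apply intervalIntegral.integral_mono_on zero_le_one (hcontF.intervalIntegrable _ _)
          hsumint.intervalIntegrable
        intro x hx
        exact hpt x hx.1
    _ ≤ ∫ x, ∑ i ∈ Finset.Icc 1 n, G i x := by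
        rw [intervalIntegral.integral_of_le zero_le_one]
        exact setIntegral_le_integral hsumint
          (Eventually.of_forall fun x => Finset.sum_nonneg fun j hj => hGnn j hj x)
    _ = ∑ i ∈ Finset.Icc 1 n, (z (2 * i - 1) - z (2 * i)) * (y i) ^ p := by
        rw [integral_finsetSum _ hGint]
        apply Finset.sum_congr rfl
        intro i hi
        rw [Finset.mem_Icc] at hi
        simp only [G]
        rw [integral_indicator measurableSet_Icc, setIntegral_const, smul_eq_mul,
          Real.volume_real_Icc_of_le (hord i hi.1 hi.2).le]
    _ ≤ _ := by
        rw [Finset.mul_sum]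
        apply Finset.sum_le_sum
        intro i hi
        rw [Finset.mem_Icc] at hi
        rw [← mul_assoc]
        exact mul_le_mul_of_nonneg_right (zero_gap n z hzmem hzanti hzall i hi.1 hi.2)
          (Real.rpow_nonneg (hy0 i hi.1 hi.2) p)
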